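/- arXiv:1801.00299 — 4 statements merged into one kernel-verified Lean document; each statement's English description precedes it below -/
import Mathlib

section
/- Let N ≥ 1, let λ₁,…,λ_N be real numbers with λ_k > 1 for all k, D := diag(λ₁,…,λ_N,λ₁,…,λ_N). Let R be N×N skew-Hermitian, Q N×N complex symmetric, ℓ ∈ ℝ^N, and set P := [[R, Q],[conj(Q), conj(R)]], L := diag(ℓ¹,…,ℓ^N,ℓ¹,…,ℓ^N), V := P D + D P† + L. Define the N×N matrices W_X and W_Y by W_X^{kl} := −((λ_k−λ_l)/(λ_k λ_l − 1))·R^{kl} + δ_{kl}·ℓ^k/(λ_k² − 1) and W_Y^{kl} := ((λ_k+λ_l)/(λ_k λ_l + 1))·Q^{kl}, and set W := [[W_X, W_Y],[conj(W_Y), conj(W_X)]]. Then W is Hermitian and D W D − K W K = V (equivalently, vec(W) = (D ⊗ D − K ⊗ K)⁻¹ vec(V)). -/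
open Matrix Kronecker BigOperators Finset

noncomputable section

abbrev Idx (N : ℕ) := Fin N ⊕ Fin N

/-- The complex-form symplectic form `K = [[I, 0], [0, -I]]`. -/
def Km (N : ℕ) : Matrix (Idx N) (Idx N) ℂ := Matrix.fromBlocks 1 0 0 (-1)

/-- Entrywise complex conjugate of a matrix. -/
def mconj {m n : Type*} (A : Matrix m n ℂ) : Matrix m n ℂ := A.map (starRingEnd ℂ)

lemma Km_eq_diagonal (N : ℕ) :
    Km N = Matrix.diagonal (Sum.elim (fun _ => (1 : ℂ)) (fun _ => -1)) := by
  rw [Km, ← Matrix.fromBlocks_diagonal, ← Matrix.diagonal_one, ← Matrix.diagonal_neg]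

theorem stmt2 (N : ℕ) (hN : 1 ≤ N)
    (lam : Fin N → ℝ) (hlam : ∀ k, 1 < lam k)
    (R Q : Matrix (Fin N) (Fin N) ℂ)
    (hR : Rᴴ = -R) (hQ : Qᵀ = Q)
    (ℓ : Fin N → ℝ) :
    let D : Matrix (Idx N) (Idx N) ℂ :=
      Matrix.diagonal (Sum.elim (fun k => (lam k : ℂ)) (fun k => (lam k : ℂ)))
    let P := Matrix.fromBlocks R Q (mconj Q) (mconj R)
    let L : Matrix (Idx N) (Idx N) ℂ :=
      Matrix.diagonal (Sum.elim (fun k => (ℓ k : ℂ)) (fun k => (ℓ k : ℂ)))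
    let V := P * D + D * Pᴴ + L
    let WX : Matrix (Fin N) (Fin N) ℂ := fun k l =>
      -((((lam k - lam l) / (lam k * lam l - 1) : ℝ) : ℂ)) * R k l
        + if k = l then (((ℓ k / ((lam k)^2 - 1) : ℝ)) : ℂ) else 0
    let WY : Matrix (Fin N) (Fin N) ℂ := fun k l =>
      ((((lam k + lam l) / (lam k * lam l + 1) : ℝ) : ℂ)) * Q k l
    let W := Matrix.fromBlocks WX WY (mconj WY) (mconj WX)
    W.IsHermitian ∧ D * W * D - Km N * W * Km N = V := by
  intro D P L V WX WY W
  have hRe (k l : Fin N) : starRingEnd ℂ (R k l) = -R l k := by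
    simpa using congrFun₂ hR l k
  have hQe (k l : Fin N) : Q k l = Q l k := by
    simpa using congrFun₂ hQ l k
  have hsub (k l : Fin N) : (lam k : ℂ) * lam l - 1 ≠ 0 := by
    have : lam k * lam l - 1 ≠ 0 := by nlinarith [hlam k, hlam l]
    exact_mod_cast this
  have hadd (k l : Fin N) : (lam k : ℂ) * lam l + 1 ≠ 0 := by
    have : lam k * lam l + 1 ≠ 0 := by nlinarith [hlam k, hlam l]
    exact_mod_cast this
  have hX (k l : Fin N) : (lam k * lam l - 1) * WX k l =
      (lam l - lam k) * R k l + if k = l then (ℓ k : ℂ) else 0 := by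
    have h := hsub k l
    rcases eq_or_ne k l with rfl | hkl
    · have h2 : (lam k : ℂ) ^ 2 - 1 ≠ 0 := by rwa [pow_two]
      simp only [WX, if_true, sub_self, zero_div]
      push_cast
      field_simp
      ring
    · simp only [WX, if_neg hkl]
      push_cast
      field_simp
      ring
  have hY (k l : Fin N) : (lam k * lam l + 1) * WY k l = (lam k + lam l) * Q k l := by
    have h := hadd k l
    simp only [WY]
    push_cast
    field_simp
  have hXconj (k l : Fin N) : (lam k * lam l - 1) * starRingEnd ℂ (WX k l) =
      (lam l - lam k) * starRingEnd ℂ (R k l) + if k = l then (ℓ k : ℂ) else 0 := by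
    simpa [apply_ite (starRingEnd ℂ)] using congrArg (starRingEnd ℂ) (hX k l)
  have hYconj (k l : Fin N) : (lam k * lam l + 1) * starRingEnd ℂ (WY k l) =
      (lam k + lam l) * starRingEnd ℂ (Q k l) := by
    simpa using congrArg (starRingEnd ℂ) (hY k l)
  have hXherm (k l : Fin N) : starRingEnd ℂ (WX k l) = WX l k := by
    apply mul_left_cancel₀ (hsub k l)
    rw [hXconj, mul_comm (lam k : ℂ), hX, hRe]
    rcases eq_or_ne k l with rfl | hkl
    · simp
    · rw [if_neg hkl, if_neg hkl.symm]
      ring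
  have hYsymm (k l : Fin N) : WY k l = WY l k := by
    apply mul_left_cancel₀ (hadd k l)
    rw [hY, mul_comm (lam k : ℂ), hY, hQe k l]
    ring
  refine ⟨?_, ?_⟩
  · ext (k | k) (l | l)
    · simp [W, hXherm]
    · simp [W, mconj, hYsymm l k]
    · simp [W, mconj, hYsymm l k]
    · simp [W, mconj, hXherm]
  · rw [Km_eq_diagonal]
    ext (k | k) (l | l)
    · simp [W, V, P, D, L, diagonal_apply, hRe]
      linear_combination hX k l
    · simp [W, V, P, D, L, mconj, hQe l k]
      linear_combination hY k l
    · simp [W, V, P, D, L, mconj, hQe l k]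
      linear_combination hYconj k l
    · have h := hXconj k l
      simp [W, V, P, D, L, mconj, diagonal_apply, hRe] at h ⊢
      linear_combination h
end
end

section
/- Let N ≥ 1 and let σ be a 2N×2N Hermitian positive-definite complex matrix satisfying T σ T = conj(σ). Then every eigenvalue of the matrix Kσ is real and nonzero, and for every λ ∈ ℂ, λ is an eigenvalue of Kσ if and only if −λ is an eigenvalue of Kσ. -/
open Matrix BigOperators
open scoped ComplexOrder

noncomputable section

/-- The block matrix `T = [[0, I], [I, 0]]`. -/
def Tm (N : ℕ) : Matrix (Idx N) (Idx N) ℂ := Matrix.fromBlocks 0 1 1 0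

/-- The spectrum of a product of square matrices does not depend on the order of the factors. -/
theorem Matrix.spectrum_mul_comm {n 𝕜 : Type*} [Fintype n] [DecidableEq n] [Field 𝕜]
    (A B : Matrix n n 𝕜) : spectrum 𝕜 (A * B) = spectrum 𝕜 (B * A) := by
  ext μ
  simp only [Matrix.mem_spectrum_iff_isRoot_charpoly, Matrix.charpoly_mul_comm A B]

/-- A square matrix and its transpose have the same spectrum. -/
theorem Matrix.spectrum_transpose {n 𝕜 : Type*} [Fintype n] [DecidableEq n] [Field 𝕜]
    (A : Matrix n n 𝕜) : spectrum 𝕜 Aᵀ = spectrum 𝕜 A := by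
  ext μ
  simp only [Matrix.mem_spectrum_iff_isRoot_charpoly, Matrix.charpoly_transpose]

/-- The eigenvalues of a Hermitian matrix times a positive definite matrix are real. -/
theorem Matrix.PosDef.im_eq_zero_of_mem_spectrum_mul {n : Type*} [Fintype n] [DecidableEq n]
    {H P : Matrix n n ℂ} (hP : P.PosDef) (hH : H.IsHermitian) {μ : ℂ}
    (hμ : μ ∈ spectrum ℂ (H * P)) : μ.im = 0 := by
  rw [← Matrix.spectrum_toLin', ← Module.End.hasEigenvalue_iff_mem_spectrum] at hμ
  obtain ⟨v, hv⟩ := hμ.exists_hasEigenvector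
  have hv_eq : (H * P) *ᵥ v = μ • v := by simpa using hv.apply_eq_smul
  have hpos := hP.dotProduct_mulVec_pos hv.2
  have hPHP : (P * H * P).IsHermitian := by
    simpa [hP.isHermitian.eq] using Matrix.isHermitian_conjTranspose_mul_mul P hH
  have him := hPHP.im_star_dotProduct_mulVec_self v
  rw [Matrix.mul_assoc, ← Matrix.mulVec_mulVec, hv_eq, Matrix.mulVec_smul, dotProduct_smul,
    smul_eq_mul] at him
  obtain ⟨hre, him'⟩ := Complex.pos_iff.mp hpos
  simpa [← him', hre.ne'] using him

theorem Km_isHermitian (N : ℕ) : (Km N).IsHermitian := by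
  simp [Matrix.IsHermitian, Km, Matrix.fromBlocks_conjTranspose]

theorem Km_transpose (N : ℕ) : (Km N)ᵀ = Km N := by
  simp [Km, Matrix.fromBlocks_transpose]

theorem Km_mul_self (N : ℕ) : Km N * Km N = 1 := by
  simp [Km, Matrix.fromBlocks_multiply]

theorem Tm_mul_self (N : ℕ) : Tm N * Tm N = 1 := by
  simp [Tm, Matrix.fromBlocks_multiply]

theorem Tm_mul_Km (N : ℕ) : Tm N * Km N = -(Km N * Tm N) := by
  simp [Tm, Km, Matrix.fromBlocks_multiply, Matrix.fromBlocks_neg]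

theorem Matrix.IsHermitian.mconj_eq_transpose {n : Type*} {A : Matrix n n ℂ}
    (hA : A.IsHermitian) : mconj A = Aᵀ := by
  ext i j
  exact hA.apply j i

/-- If `T σ T` is the conjugate of the Hermitian matrix `σ`, the spectrum of `K σ` is symmetric
about the origin. -/
theorem neg_spectrum_Km_mul {N : ℕ} {σ : Matrix (Idx N) (Idx N) ℂ} (hσ : σ.IsHermitian)
    (hstruct : Tm N * σ * Tm N = mconj σ) :
    -spectrum ℂ (Km N * σ) = spectrum ℂ (Km N * σ) := by
  have hconj : -(Tm N * (Km N * σ * Tm N)) = (σ * Km N)ᵀ := by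
    rw [Matrix.transpose_mul, Km_transpose, ← hσ.mconj_eq_transpose, ← hstruct]
    simp only [← Matrix.mul_assoc, Tm_mul_Km, Matrix.neg_mul, neg_neg]
  calc -spectrum ℂ (Km N * σ)
      = -spectrum ℂ (Tm N * (Km N * σ * Tm N)) := by
        rw [Matrix.spectrum_mul_comm (Tm N), Matrix.mul_assoc, Tm_mul_self, Matrix.mul_one]
    _ = spectrum ℂ (σ * Km N)ᵀ := by rw [spectrum.neg_eq, hconj]
    _ = spectrum ℂ (Km N * σ) := by
        rw [Matrix.spectrum_transpose, Matrix.spectrum_mul_comm]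

theorem stmt9 (N : ℕ) (hN : 1 ≤ N)
    (σ : Matrix (Idx N) (Idx N) ℂ) (hσ : σ.PosDef)
    (hstruct : Tm N * σ * Tm N = mconj σ) :
    (∀ μ ∈ spectrum ℂ (Km N * σ), μ.im = 0 ∧ μ ≠ 0) ∧
    (∀ μ : ℂ, μ ∈ spectrum ℂ (Km N * σ) ↔ -μ ∈ spectrum ℂ (Km N * σ)) := by
  refine ⟨fun μ hμ => ⟨hσ.im_eq_zero_of_mem_spectrum_mul (Km_isHermitian N) hμ, ?_⟩, fun μ => ?_⟩
  · rintro rfl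
    exact spectrum.zero_mem_iff ℂ |>.mp hμ ((IsUnit.of_mul_eq_one _ (Km_mul_self N)).mul hσ.isUnit)
  · rw [← Set.mem_neg, neg_spectrum_Km_mul hσ.isHermitian hstruct]
end
end

section
/- Let N ≥ 1 and let σ be a 2N×2N Hermitian complex matrix with (Kσ)² = I. Then σ is invertible and σ⁻¹ = K σ K. If moreover V is a 2N×2N complex matrix satisfying (Kσ)(KV) + (KV)(Kσ) = 0, then σ⁻¹ V σ⁻¹ = −K V K; consequently X := (1/2) σ⁻¹ V σ⁻¹ satisfies σ X σ − K X K = V. -/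
open Matrix BigOperators

noncomputable section

theorem stmt14 (N : ℕ) (hN : 1 ≤ N)
    (σ : Matrix (Idx N) (Idx N) ℂ) (hσ : σ.IsHermitian)
    (hpure : (Km N * σ) ^ 2 = 1) :
    IsUnit σ ∧ σ⁻¹ = Km N * σ * Km N ∧
    ∀ V : Matrix (Idx N) (Idx N) ℂ,
      (Km N * σ) * (Km N * V) + (Km N * V) * (Km N * σ) = 0 →
      σ⁻¹ * V * σ⁻¹ = -(Km N * V * Km N) ∧
      (let X : Matrix (Idx N) (Idx N) ℂ := (1/2 : ℂ) • (σ⁻¹ * V * σ⁻¹)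
       σ * X * σ - Km N * X * Km N = V) := by
  have hK : Km N * Km N = 1 := by simp [Km, Matrix.fromBlocks_multiply]
  have hl : Km N * σ * Km N * σ = 1 := by rw [← hpure, pow_two]; simp only [mul_assoc]
  have hr : σ * (Km N * σ * Km N) = 1 := mul_eq_one_comm.mp hl
  have hinv : σ⁻¹ = Km N * σ * Km N := Matrix.inv_eq_left_inv hl
  refine ⟨.of_mul_eq_one _ hr, hinv, fun V hV => ?_⟩
  have hVinv : σ⁻¹ * V * σ⁻¹ = -(Km N * V * Km N) :=
    calc σ⁻¹ * V * σ⁻¹ = Km N * σ * (Km N * V) * (Km N * σ * Km N) := by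
          rw [hinv]; simp only [mul_assoc]
      _ = -(Km N * V * (Km N * σ)) * (Km N * σ * Km N) := by
          rw [eq_neg_of_add_eq_zero_left hV]
      _ = -(Km N * V * (Km N * (σ * (Km N * σ * Km N)))) := by
          simp only [neg_mul, mul_assoc]
      _ = -(Km N * V * Km N) := by rw [hr, mul_one]
  have hσV : σ * (σ⁻¹ * V * σ⁻¹) * σ = V := by
    rw [← hinv] at hr
    have hl' : σ⁻¹ * σ = 1 := mul_eq_one_comm.mp hr
    rw [mul_assoc, mul_assoc, hl', mul_one, ← mul_assoc, hr, one_mul]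
  have hKV : Km N * (σ⁻¹ * V * σ⁻¹) * Km N = -V := by
    rw [hVinv, mul_neg, neg_mul, mul_assoc, mul_assoc, hK, mul_one, ← mul_assoc, hK, one_mul]
  refine ⟨hVinv, ?_⟩
  simp only [mul_smul_comm, smul_mul_assoc, hσV, hKV]
  module
end
end

section
/- Let N ≥ 1, let S be an invertible 2N×2N complex matrix with S K S† = K, and set σ := S S†. For a ∈ {1,2}, let R_a be an N×N skew-Hermitian complex matrix and Q_a an N×N complex symmetric matrix, set P_a := [[R_a, Q_a],[conj(Q_a), conj(R_a)]] and V_a := S (P_a + P_a†) S†. Then σ is invertible and (1/4) tr( σ⁻¹ V₁ σ⁻¹ V₂ ) = 2 Σ_{k,l=1}^N Re( conj(Q₁^{kl}) Q₂^{kl} ). -/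
open Matrix BigOperators Finset

noncomputable section

theorem mconj_eq_conjTranspose {n : Type*} {Q : Matrix n n ℂ} (hQ : Qᵀ = Q) : mconj Q = Qᴴ := by
  conv_rhs => rw [← hQ]
  rfl

theorem fromBlocks_add_conjTranspose {n : Type*} {R Q : Matrix n n ℂ}
    (hR : Rᴴ = -R) (hQ : Qᵀ = Q) :
    fromBlocks R Q (mconj Q) (mconj R) + (fromBlocks R Q (mconj Q) (mconj R))ᴴ =
      fromBlocks 0 ((2 : ℂ) • Q) ((2 : ℂ) • Qᴴ) 0 := by
  have hR' : mconj R + (mconj R)ᴴ = 0 := by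
    ext i j
    have h := congrFun₂ hR j i
    simp only [conjTranspose_apply, RCLike.star_def] at h
    simp [mconj, h]
  rw [fromBlocks_conjTranspose, fromBlocks_add, hR', hR, mconj_eq_conjTranspose hQ,
    conjTranspose_conjTranspose, add_neg_cancel, two_smul, two_smul]

theorem trace_fromBlocks_add {m n R : Type*} [Fintype m] [Fintype n] [AddCommMonoid R]
    (A : Matrix m m R) (B : Matrix m n R) (C : Matrix n m R) (D : Matrix n n R) :
    (fromBlocks A B C D).trace = A.trace + D.trace := by
  simp [trace]

theorem trace_inv_mul_congr {n : Type*} [Fintype n] [DecidableEq n] {S : Matrix n n ℂ}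
    (hS : IsUnit S) (X Y : Matrix n n ℂ) :
    ((S * Sᴴ)⁻¹ * (S * X * Sᴴ) * (S * Sᴴ)⁻¹ * (S * Y * Sᴴ)).trace = (X * Y).trace := by
  have hd : IsUnit S.det := (isUnit_iff_isUnit_det S).1 hS
  have hd' : IsUnit Sᴴ.det := by rw [det_conjTranspose]; exact hd.star
  have h (Z : Matrix n n ℂ) : (S * Sᴴ)⁻¹ * (S * Z * Sᴴ) = Sᴴ⁻¹ * (Z * Sᴴ) := by
    rw [Matrix.mul_inv_rev, Matrix.mul_assoc, Matrix.mul_assoc S, nonsing_inv_mul_cancel_left _ _ hd]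
  rw [Matrix.mul_assoc, h, h, trace_mul_comm]
  rw [Matrix.mul_assoc, trace_mul_comm]
  simp only [Matrix.mul_assoc]
  rw [mul_nonsing_inv_cancel_left _ _ hd', mul_nonsing_inv _ hd', Matrix.mul_one,
    trace_mul_comm]

theorem trace_conjTranspose_mul_add {n : Type*} [Fintype n] (A B : Matrix n n ℂ) :
    (A * Bᴴ).trace + (Aᴴ * B).trace =
      ((2 * ∑ k, ∑ l, ((starRingEnd ℂ) (A k l) * B k l).re : ℝ) : ℂ) := by
  rw [trace_mul_comm Aᴴ B]
  simp only [trace, diag_apply, mul_apply, conjTranspose_apply, RCLike.star_def,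
    ← Finset.sum_add_distrib, Complex.ofReal_mul, Complex.ofReal_sum, Finset.mul_sum]
  refine Finset.sum_congr rfl fun k _ => Finset.sum_congr rfl fun l _ => ?_
  apply Complex.ext <;> simp <;> ring

theorem stmt16 (N : ℕ) (hN : 1 ≤ N)
    (S : Matrix (Idx N) (Idx N) ℂ) (hS : IsUnit S)
    (hsymp : S * Km N * Sᴴ = Km N)
    (R₁ R₂ Q₁ Q₂ : Matrix (Fin N) (Fin N) ℂ)
    (hR₁ : R₁ᴴ = -R₁) (hR₂ : R₂ᴴ = -R₂)
    (hQ₁ : Q₁ᵀ = Q₁) (hQ₂ : Q₂ᵀ = Q₂) :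
    let σ := S * Sᴴ
    let P₁ := Matrix.fromBlocks R₁ Q₁ (mconj Q₁) (mconj R₁)
    let P₂ := Matrix.fromBlocks R₂ Q₂ (mconj Q₂) (mconj R₂)
    let V₁ := S * (P₁ + P₁ᴴ) * Sᴴ
    let V₂ := S * (P₂ + P₂ᴴ) * Sᴴ
    IsUnit σ ∧
      (1/4 : ℂ) * (σ⁻¹ * V₁ * σ⁻¹ * V₂).trace =
        ((2 * ∑ k : Fin N, ∑ l : Fin N,
            ((starRingEnd ℂ) (Q₁ k l) * Q₂ k l).re : ℝ) : ℂ) := by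
  intro σ P₁ P₂ V₁ V₂
  refine ⟨hS.mul hS.star, ?_⟩
  rw [← trace_conjTranspose_mul_add, trace_inv_mul_congr hS,
    fromBlocks_add_conjTranspose hR₁ hQ₁, fromBlocks_add_conjTranspose hR₂ hQ₂,
    fromBlocks_multiply, trace_fromBlocks_add]
  simp only [Matrix.mul_zero, zero_add, add_zero, Matrix.smul_mul, Matrix.mul_smul,
    trace_smul, smul_eq_mul]
  ring
end
end
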